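/- arXiv:1201.1455 — 2 statements merged into one kernel-verified Lean document; each statement's English description precedes it below -/
import Mathlib

section
/- Let 1 < p < ∞, 1/p + 1/p' = 1, let μ and ν be Radon measures on ℝ^N, let ℒ ⊆ 𝒟 be a collection of dyadic cubes, and let f ≥ 0, g ≥ 0 be measurable functions on ℝ^N such that for all I ∈ ℒ the splitting condition holds: μ(I)^{1-p} (∫_I f dμ)^p ≥ ν(I)^{1-p'} (∫_I g dν)^{p'}. Let α_I ≥ 0, I ∈ ℒ, be such that for all I₀ ∈ ℒ one has ∫_{I₀} (Σ_{I∈ℒ, I⊆I₀} α_I μ(I) 𝟙_I)^p dν ≤ μ(I₀). Then Σ_{I∈ℒ} (∫_I f dμ)(∫_I g dν) α_I ≤ A ‖f‖_{L^p(μ)} ‖g‖_{L^{p'}(ν)} + B ‖f‖_{L^p(μ)}^p, where A = 2^{1+1/p} p' and B = 4 (p')^p. -/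
open MeasureTheory ENNReal Set

noncomputable section

/-- Index of a dyadic cube in `ℝ^N`: a pair `(k, m)` with `k : ℤ` the scale and
`m : Fin N → ℤ` the position; the cube is `2^{-k}(m + [0,1)^N)`. -/
abbrev DIdx (N : ℕ) := ℤ × (Fin N → ℤ)

/-- The dyadic cube `2^{-k}(m + [0,1)^N)` associated to an index. -/
def dyCube {N : ℕ} (I : DIdx N) : Set (Fin N → ℝ) :=
  {x | ∀ i, (I.2 i : ℝ) * (2 : ℝ) ^ (-I.1) ≤ x i ∧ x i < ((I.2 i : ℝ) + 1) * (2 : ℝ) ^ (-I.1)}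

/-- The function `Σ_{I ∈ ℒ, I ⊆ I₀} α_I μ(I) 𝟙_I` appearing in the testing condition. -/
def testFunL {N : ℕ} (ℒ : Set (DIdx N)) (μ : Measure (Fin N → ℝ)) (α : DIdx N → ℝ)
    (I₀ : DIdx N) (x : Fin N → ℝ) : ℝ≥0∞ :=
  ∑' I : {I : DIdx N // I ∈ ℒ ∧ dyCube I ⊆ dyCube I₀},
    (dyCube I.1).indicator (fun _ => ENNReal.ofReal (α I.1) * μ (dyCube I.1)) x

/-- Induction on a finite set in which each new element is minimal. -/
theorem finset_induction_minimal {β : Type*} [PartialOrder β] [DecidableEq β]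
    {P : Finset β → Prop} (h0 : P ∅)
    (h1 : ∀ (F : Finset β) (I : β), I ∉ F → (∀ J ∈ F, ¬ J < I) → P F → P (insert I F))
    (F : Finset β) : P F := by
  induction F using Finset.strongInduction with
  | H F ih =>
    rcases F.eq_empty_or_nonempty with rfl | hF
    · exact h0
    · obtain ⟨I, hI⟩ := F.exists_minimal hF
      rw [← Finset.insert_erase hI.prop]
      exact h1 _ I (Finset.notMem_erase I F) (fun J hJ => hI.not_lt (Finset.mem_of_mem_erase hJ))
        (ih _ (Finset.erase_ssubset hI.prop))

/-- A finite family of sets contains a stopping subfamily, along which `a` at least doubles and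
which controls `a` on the whole family. -/
theorem exists_stopping_family {X : Type*} (F : Finset (Set X)) (a : Set X → ℝ≥0∞) :
    ∃ G ⊆ F, (∀ J ∈ G, ∀ K ∈ G, K ⊂ J → 2 * a J ≤ a K) ∧
      ∀ I ∈ F, ∃ J ∈ G, I ⊆ J ∧ a I ≤ 2 * a J := by
  classical
  induction F using finset_induction_minimal with
  | h0 => exact ⟨∅, by simp⟩
  | h1 F I hI hmin ih =>
    obtain ⟨G, hGF, hG, hFG⟩ := ih
    by_cases h : ∃ J ∈ G, I ⊆ J ∧ a I ≤ 2 * a J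
    · refine ⟨G, hGF.trans (Finset.subset_insert _ _), hG, fun K hK => ?_⟩
      rcases Finset.mem_insert.1 hK with rfl | hK
      · exact h
      · exact hFG K hK
    · push Not at h
      refine ⟨insert I G, Finset.insert_subset_insert _ hGF, fun J hJ K hK hKJ => ?_,
        fun K hK => ?_⟩
      · rcases Finset.mem_insert.1 hJ with rfl | hJG
        · rcases Finset.mem_insert.1 hK with rfl | hKG
          · exact absurd hKJ (ssubset_irrefl _)
          · exact absurd hKJ (hmin K (hGF hKG))
        · rcases Finset.mem_insert.1 hK with rfl | hKG
          · exact (h J hJG hKJ.subset).le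
          · exact hG J hJG K hKG hKJ
      · rcases Finset.mem_insert.1 hK with rfl | hK
        · exact ⟨K, Finset.mem_insert_self _ _, subset_rfl, le_mul_of_one_le_left' one_le_two⟩
        · obtain ⟨J, hJ, h⟩ := hFG K hK
          exact ⟨J, Finset.mem_insert_of_mem hJ, h⟩

/-- The pointwise maximum of the step functions `a J · 𝟙_J`, `J ∈ G`. -/
def stepMax {X : Type*} (G : Finset (Set X)) (a : Set X → ℝ≥0∞) (x : X) : ℝ≥0∞ :=
  ⨆ J ∈ G, J.indicator (fun _ => a J) x

theorem stepMax_insert {X : Type*} [DecidableEq (Set X)] (G : Finset (Set X)) (a : Set X → ℝ≥0∞)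
    (I : Set X) (x : X) :
    stepMax (insert I G) a x = I.indicator (fun _ => a I) x ⊔ stepMax G a x := by
  simp [stepMax, iSup_or, iSup_sup_eq]

theorem measurable_stepMax {X : Type*} [MeasurableSpace X] {G : Finset (Set X)}
    (hG : ∀ J ∈ G, MeasurableSet J) (a : Set X → ℝ≥0∞) : Measurable (stepMax G a) :=
  Measurable.biSup _ G.countable_toSet fun J hJ => measurable_const.indicator (hG J hJ)

/-- If no member of a laminar family lies strictly inside `I`, then `stepMax` is constant on `I`. -/
theorem stepMax_eq_of_mem {X : Type*} {G : Finset (Set X)} (a : Set X → ℝ≥0∞) {I : Set X}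
    (hI : ∀ J ∈ G, I ⊆ J ∨ Disjoint I J) {x : X} (hx : x ∈ I) :
    stepMax G a x = ⨆ J ∈ G, ⨆ _ : I ⊆ J, a J := by
  refine le_antisymm (iSup₂_le fun J hJ => ?_)
    (iSup₂_le fun J hJ => iSup_le fun h => ?_)
  · rcases hI J hJ with h | h
    · rw [indicator_of_mem (h hx)]
      exact le_iSup₂_of_le J hJ (le_iSup_of_le h le_rfl)
    · rw [indicator_of_notMem (disjoint_left.1 h hx)]
      exact zero_le
  · refine le_iSup₂_of_le J hJ ?_
    rw [indicator_of_mem (h hx)]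

theorem ENNReal.young_rpow_sub {p q : ℝ} (hpq : p.HolderConjugate q) (a c : ℝ≥0∞) :
    ENNReal.ofReal q * (a * c ^ (p - 1)) + a ^ p ≤ ENNReal.ofReal q * a ^ p + c ^ p := by
  have hq := hpq.symm.pos
  have hp := hpq.pos
  have h := ENNReal.young_inequality a (c ^ (p - 1)) hpq
  rw [← ENNReal.rpow_mul, hpq.sub_one_mul_conj] at h
  have hq0 : ENNReal.ofReal q ≠ 0 := by simpa using hq
  have h1 : ENNReal.ofReal q / ENNReal.ofReal p + 1 = ENNReal.ofReal q := by
    rw [← ENNReal.ofReal_div_of_pos hp, ← ENNReal.ofReal_one,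
      ← ENNReal.ofReal_add (by positivity) zero_le_one]
    congr 1
    have := hpq.symm.sub_one_mul_conj
    field_simp
    linarith
  calc ENNReal.ofReal q * (a * c ^ (p - 1)) + a ^ p
      ≤ ENNReal.ofReal q * (a ^ p / ENNReal.ofReal p + c ^ p / ENNReal.ofReal q) + a ^ p := by
        gcongr
    _ = (ENNReal.ofReal q / ENNReal.ofReal p + 1) * a ^ p + c ^ p := by
        rw [mul_add, ENNReal.mul_div_cancel hq0 ENNReal.ofReal_ne_top, div_eq_mul_inv,
          div_eq_mul_inv]
        ring
    _ = _ := by rw [h1]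

theorem stepMax_estimates {X : Type*} [MeasurableSpace X] {μ : Measure X} {p q : ℝ}
    (hpq : p.HolderConjugate q) {f : X → ℝ≥0∞} {a : Set X → ℝ≥0∞} (G : Finset (Set X))
    (hmeas : ∀ J ∈ G, MeasurableSet J) (hfin : ∀ J ∈ G, μ J ≠ ∞) (hafin : ∀ J ∈ G, a J ≠ ∞)
    (ha : ∀ J ∈ G, μ J * a J = ∫⁻ x in J, f x ∂μ)
    (hnest : ∀ I ∈ G, ∀ J ∈ G, I ⊆ J ∨ J ⊆ I ∨ Disjoint I J)
    (hdouble : ∀ J ∈ G, ∀ K ∈ G, K ⊂ J → 2 * a J ≤ a K) :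
    ∫⁻ x, stepMax G a x ^ p ∂μ ≠ ∞ ∧
    ∑ J ∈ G, a J ^ p * μ J ≤ 2 * ∫⁻ x, stepMax G a x ^ p ∂μ ∧
    ∫⁻ x, stepMax G a x ^ p ∂μ ≤
      ENNReal.ofReal q * ∫⁻ x, f x * stepMax G a x ^ (p - 1) ∂μ := by
  classical
  have hp := hpq.pos
  have hp1 := hpq.lt
  induction G using finset_induction_minimal with
  | h0 => simp [stepMax, hp]
  | h1 G I hI hmin ih =>
    have hsub : G ⊆ insert I G := Finset.subset_insert _ _
    have hIm : I ∈ insert I G := Finset.mem_insert_self _ _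
    obtain ⟨ih0, ih1, ih2⟩ := ih (fun J hJ => hmeas J (hsub hJ)) (fun J hJ => hfin J (hsub hJ))
      (fun J hJ => hafin J (hsub hJ)) (fun J hJ => ha J (hsub hJ))
      (fun J hJ K hK => hnest J (hsub hJ) K (hsub hK))
      (fun J hJ K hK => hdouble J (hsub hJ) K (hsub hK))
    have hImeas := hmeas I hIm
    have hnestI : ∀ J ∈ G, I ⊆ J ∨ Disjoint I J := fun J hJ => by
      rcases hnest I hIm J (hsub hJ) with h | h | h
      · exact Or.inl h
      · exact Or.inl (by_contra fun h' => hmin J hJ ⟨h, h'⟩)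
      · exact Or.inr h
    set c : ℝ≥0∞ := ⨆ J ∈ G, ⨆ _ : I ⊆ J, a J with hc
    have hold : ∀ x ∈ I, stepMax G a x = c := fun x hx => stepMax_eq_of_mem a hnestI hx
    have hca : 2 * c ≤ a I := by
      simp only [hc, ENNReal.mul_iSup]
      refine iSup₂_le fun J hJ => iSup_le fun h => hdouble J (hsub hJ) I hIm ?_
      exact h.ssubset_of_ne (fun h' => hI (h' ▸ hJ))
    have hca' : c ≤ a I := le_trans (le_mul_of_one_le_left' one_le_two) hca
    have hnew : ∀ x ∈ I, stepMax (insert I G) a x = a I := fun x hx => by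
      rw [stepMax_insert, indicator_of_mem hx, hold x hx, sup_eq_left.2 hca']
    have hoff : ∀ x ∈ Iᶜ, stepMax (insert I G) a x = stepMax G a x := fun x hx => by
      rw [stepMax_insert, indicator_of_notMem hx]; simp
    have hcfin : c ≠ ∞ := ne_top_of_le_ne_top (hafin I hIm) hca'
    have split : ∀ (u : X → ℝ≥0∞), ∫⁻ x, u x ∂μ = ∫⁻ x in I, u x ∂μ + ∫⁻ x in Iᶜ, u x ∂μ :=
      fun u => (lintegral_add_compl u hImeas).symm
    have e1 : ∫⁻ x, stepMax G a x ^ p ∂μ = c ^ p * μ I + ∫⁻ x in Iᶜ, stepMax G a x ^ p ∂μ := by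
      rw [split, setLIntegral_congr_fun hImeas (fun x hx => by rw [hold x hx]), setLIntegral_const]
    have e2 : ∫⁻ x, stepMax (insert I G) a x ^ p ∂μ
        = a I ^ p * μ I + ∫⁻ x in Iᶜ, stepMax G a x ^ p ∂μ := by
      rw [split, setLIntegral_congr_fun hImeas (fun x hx => by rw [hnew x hx]), setLIntegral_const,
        setLIntegral_congr_fun hImeas.compl (fun x hx => by rw [hoff x hx])]
    have hcp : c ^ (p - 1) ≠ ∞ := ENNReal.rpow_ne_top_of_nonneg (by linarith) hcfin
    have hap : a I ^ (p - 1) ≠ ∞ := ENNReal.rpow_ne_top_of_nonneg (by linarith) (hafin I hIm)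
    have e3 : ∫⁻ x, f x * stepMax G a x ^ (p - 1) ∂μ
        = a I * c ^ (p - 1) * μ I + ∫⁻ x in Iᶜ, f x * stepMax G a x ^ (p - 1) ∂μ := by
      rw [split, setLIntegral_congr_fun hImeas (fun x hx => by rw [hold x hx]),
        lintegral_mul_const' _ _ hcp, ← ha I hIm]
      ring
    have e4 : ∫⁻ x, f x * stepMax (insert I G) a x ^ (p - 1) ∂μ
        = a I ^ p * μ I + ∫⁻ x in Iᶜ, f x * stepMax G a x ^ (p - 1) ∂μ := by
      have : a I ^ p = a I * a I ^ (p - 1) := by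
        conv_rhs => rw [← ENNReal.rpow_one (a I), ← ENNReal.rpow_mul, one_mul]
        rw [← ENNReal.rpow_add_of_nonneg _ _ zero_le_one (by linarith)]
        ring_nf
      rw [split, setLIntegral_congr_fun hImeas (fun x hx => by rw [hnew x hx]),
        setLIntegral_congr_fun hImeas.compl (fun x hx => by rw [hoff x hx]),
        lintegral_mul_const' _ _ hap, ← ha I hIm, this]
      ring
    have hcμ : c ^ p * μ I ≠ ∞ :=
      ENNReal.mul_ne_top (ENNReal.rpow_ne_top_of_nonneg hp.le hcfin) (hfin I hIm)
    rw [e2, e4]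
    rw [e1] at ih0 ih1 ih2
    rw [e3] at ih2
    have h2c : 2 * c ^ p ≤ a I ^ p := by
      calc 2 * c ^ p ≤ 2 ^ p * c ^ p := by
            gcongr
            exact ENNReal.le_rpow_self_of_one_le one_le_two hp1.le
        _ = (2 * c) ^ p := (ENNReal.mul_rpow_of_nonneg _ _ hp.le).symm
        _ ≤ a I ^ p := by gcongr
    refine ⟨?_, ?_, ?_⟩
    · exact ENNReal.add_ne_top.2 ⟨ENNReal.mul_ne_top
        (ENNReal.rpow_ne_top_of_nonneg hp.le (hafin I hIm)) (hfin I hIm),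
        (ENNReal.add_ne_top.1 ih0).2⟩
    · rw [Finset.sum_insert hI]
      calc a I ^ p * μ I + ∑ J ∈ G, a J ^ p * μ J
          ≤ a I ^ p * μ I + (2 * c ^ p * μ I + 2 * ∫⁻ x in Iᶜ, stepMax G a x ^ p ∂μ) := by
            gcongr
            exact ih1.trans_eq (by ring)
        _ ≤ a I ^ p * μ I + (a I ^ p * μ I + 2 * ∫⁻ x in Iᶜ, stepMax G a x ^ p ∂μ) := by gcongr
        _ = _ := by ring
    · rw [← ENNReal.add_le_add_iff_right hcμ]
      calc a I ^ p * μ I + ∫⁻ x in Iᶜ, stepMax G a x ^ p ∂μ + c ^ p * μ I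
          = a I ^ p * μ I + (c ^ p * μ I + ∫⁻ x in Iᶜ, stepMax G a x ^ p ∂μ) := by ring
        _ ≤ a I ^ p * μ I + ENNReal.ofReal q * (a I * c ^ (p - 1) * μ I +
              ∫⁻ x in Iᶜ, f x * stepMax G a x ^ (p - 1) ∂μ) := by gcongr
        _ = (ENNReal.ofReal q * (a I * c ^ (p - 1)) + a I ^ p) * μ I +
              ENNReal.ofReal q * ∫⁻ x in Iᶜ, f x * stepMax G a x ^ (p - 1) ∂μ := by ring
        _ ≤ (ENNReal.ofReal q * a I ^ p + c ^ p) * μ I +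
              ENNReal.ofReal q * ∫⁻ x in Iᶜ, f x * stepMax G a x ^ (p - 1) ∂μ := by
            exact add_le_add (mul_le_mul' (ENNReal.young_rpow_sub hpq _ _) le_rfl) le_rfl
        _ = _ := by ring

/-- A dyadic Carleson embedding theorem along a stopping family. -/
theorem sum_rpow_mul_measure_le {X : Type*} [MeasurableSpace X] {μ : Measure X} {p q : ℝ}
    (hpq : p.HolderConjugate q) {f : X → ℝ≥0∞} (hf : Measurable f) {a : Set X → ℝ≥0∞}
    (G : Finset (Set X))
    (hmeas : ∀ J ∈ G, MeasurableSet J) (hfin : ∀ J ∈ G, μ J ≠ ∞) (hafin : ∀ J ∈ G, a J ≠ ∞)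
    (ha : ∀ J ∈ G, μ J * a J = ∫⁻ x in J, f x ∂μ)
    (hnest : ∀ I ∈ G, ∀ J ∈ G, I ⊆ J ∨ J ⊆ I ∨ Disjoint I J)
    (hdouble : ∀ J ∈ G, ∀ K ∈ G, K ⊂ J → 2 * a J ≤ a K) :
    ∑ J ∈ G, a J ^ p * μ J ≤ 2 * (ENNReal.ofReal q ^ p * ∫⁻ x, f x ^ p ∂μ) := by
  obtain ⟨h0, h1, h2⟩ := stepMax_estimates hpq G hmeas hfin hafin ha hnest hdouble
  refine h1.trans (mul_le_mul_right ?_ _)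
  have hp := hpq.pos
  have hq := hpq.symm.pos
  have h3 := h2.trans (mul_le_mul_right (ENNReal.lintegral_mul_le_Lp_mul_Lq μ hpq hf.aemeasurable
    ((measurable_stepMax hmeas a).pow_const (p - 1)).aemeasurable) _)
  simp only [← ENNReal.rpow_mul, hpq.sub_one_mul_conj] at h3
  set M := ∫⁻ x, stepMax G a x ^ p ∂μ
  rcases eq_or_ne M 0 with hM | hM
  · simp [hM]
  have hMM : M = M ^ (1 / p) * M ^ (1 / q) := by
    rw [← ENNReal.rpow_add _ _ hM h0, one_div, one_div, hpq.inv_add_inv_eq_one, ENNReal.rpow_one]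
  have h4 : M ^ (1 / p) ≤ ENNReal.ofReal q * (∫⁻ x, f x ^ p ∂μ) ^ (1 / p) := by
    rw [← ENNReal.mul_le_mul_iff_left (c := M ^ (1 / q)), ← hMM, mul_assoc]
    · exact h3
    · exact (ENNReal.rpow_pos (pos_iff_ne_zero.2 hM) h0).ne'
    · exact ENNReal.rpow_ne_top_of_nonneg (by positivity) h0
  have h5 := ENNReal.rpow_le_rpow h4 hp.le
  rwa [ENNReal.mul_rpow_of_nonneg _ _ hp.le, ← ENNReal.rpow_mul, ← ENNReal.rpow_mul,
    one_div_mul_cancel hp.ne', ENNReal.rpow_one, ENNReal.rpow_one] at h5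

theorem measure_rpow_mul_setLIntegral_rpow {X : Type*} [MeasurableSpace X] {μ : Measure X}
    {p : ℝ} (hp : 1 < p) (f : X → ℝ≥0∞) {I : Set X} (hI : μ I ≠ ∞) :
    μ I ^ (1 - p) * (∫⁻ x in I, f x ∂μ) ^ p = (⨍⁻ x in I, f x ∂μ) ^ p * μ I := by
  have hp0 : 0 < p := by linarith
  rw [← measure_mul_setLAverage f hI, ENNReal.mul_rpow_of_nonneg _ _ hp0.le]
  rcases eq_or_ne (μ I) 0 with h | h
  · simp [h, hp0]
  · rw [← mul_assoc, ← ENNReal.rpow_add _ _ h hI, sub_add_cancel, ENNReal.rpow_one, mul_comm]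

theorem setLIntegral_ne_top_of_rpow {X : Type*} [MeasurableSpace X] {μ : Measure X} {p q : ℝ}
    (hpq : p.HolderConjugate q) {f : X → ℝ≥0∞} (hf : Measurable f)
    (hfp : ∫⁻ x, f x ^ p ∂μ ≠ ∞) {I : Set X} (hI : μ I ≠ ∞) : ∫⁻ x in I, f x ∂μ ≠ ∞ := by
  have h := ENNReal.lintegral_mul_le_Lp_mul_Lq (μ.restrict I) hpq hf.aemeasurable
    (aemeasurable_const (b := (1 : ℝ≥0∞)))
  have hp := hpq.pos
  have hq := hpq.symm.pos
  simp only [Pi.mul_apply, mul_one, ENNReal.one_rpow, lintegral_const,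
    Measure.restrict_apply_univ, one_mul] at h
  refine ne_top_of_le_ne_top (ENNReal.mul_ne_top ?_ ?_) h
  · exact ENNReal.rpow_ne_top_of_nonneg (by positivity)
      (ne_top_of_le_ne_top hfp (setLIntegral_le_lintegral _ _))
  · exact ENNReal.rpow_ne_top_of_nonneg (by positivity) hI

/-- Hölder's inequality on `J`, where `g` may be replaced by its averages over disjoint sets on
which the other factor is constant. -/
theorem setLIntegral_mul_le_of_eq_const {X : Type*} [MeasurableSpace X] {ν : Measure X} {p q : ℝ}
    (hpq : p.HolderConjugate q) {S g : X → ℝ≥0∞} (hS : Measurable S) (hg : Measurable g)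
    {J : Set X} (C : Finset (Set X))
    (hmeas : ∀ K ∈ C, MeasurableSet K) (hfin : ∀ K ∈ C, ν K ≠ ∞) (hCJ : ∀ K ∈ C, K ⊆ J)
    (hdisj : (C : Set (Set X)).PairwiseDisjoint id)
    (s : Set X → ℝ≥0∞) (hs : ∀ K ∈ C, ∀ x ∈ K, S x = s K) :
    ∫⁻ x in J, S x * g x ∂ν ≤ (∫⁻ x in J, S x ^ p ∂ν) ^ (1 / p) *
      ((∫⁻ x in J \ ⋃ K ∈ C, K, g x ^ q ∂ν) ^ (1 / q) +
        (∑ K ∈ C, (⨍⁻ x in K, g x ∂ν) ^ q * ν K) ^ (1 / q)) := by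
  have hp := hpq.pos
  have hq := hpq.symm.pos
  have hU : MeasurableSet (⋃ K ∈ C, K) := Finset.measurableSet_biUnion _ hmeas
  have hUJ : (⋃ K ∈ C, K) ⊆ J := iUnion₂_subset hCJ
  have hunion (u : X → ℝ≥0∞) : ∫⁻ x in ⋃ K ∈ C, K, u x ∂ν = ∑ K ∈ C, ∫⁻ x in K, u x ∂ν :=
    lintegral_biUnion_finset hdisj hmeas u
  have hsplit : ∫⁻ x in J, S x * g x ∂ν = ∫⁻ x in J \ ⋃ K ∈ C, K, S x * g x ∂ν +
      ∑ K ∈ C, ∫⁻ x in K, S x * g x ∂ν := by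
    rw [← hunion, ← lintegral_union hU disjoint_sdiff_left, sdiff_union_of_subset hUJ]
  have hsp : ∑ K ∈ C, s K ^ p * ν K ≤ ∫⁻ x in J, S x ^ p ∂ν := by
    calc ∑ K ∈ C, s K ^ p * ν K = ∑ K ∈ C, ∫⁻ x in K, S x ^ p ∂ν :=
          Finset.sum_congr rfl fun K hK => by
            rw [setLIntegral_congr_fun (hmeas K hK) (fun x hx => by rw [hs K hK x hx]),
              setLIntegral_const]
      _ = ∫⁻ x in ⋃ K ∈ C, K, S x ^ p ∂ν := (hunion _).symm
      _ ≤ _ := lintegral_mono_set hUJ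
  rw [hsplit, mul_add]
  refine add_le_add ?_ ?_
  · refine (ENNReal.lintegral_mul_le_Lp_mul_Lq _ hpq hS.aemeasurable hg.aemeasurable).trans ?_
    gcongr
    exact sdiff_subset
  · calc ∑ K ∈ C, ∫⁻ x in K, S x * g x ∂ν
        = ∑ K ∈ C, (s K * ν K ^ (1 / p)) * ((⨍⁻ x in K, g x ∂ν) * ν K ^ (1 / q)) :=
          Finset.sum_congr rfl fun K hK => by
            rw [setLIntegral_congr_fun (hmeas K hK)
              (fun x hx => by rw [hs K hK x hx]), lintegral_const_mul _ hg,
              ← measure_mul_setLAverage g (hfin K hK)]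
            have : ν K = ν K ^ (1 / p) * ν K ^ (1 / q) := by
              rw [← ENNReal.rpow_add_of_nonneg _ _ (by positivity) (by positivity), one_div,
                one_div, hpq.inv_add_inv_eq_one, ENNReal.rpow_one]
            conv_lhs => rw [this]
            ring
      _ ≤ (∑ K ∈ C, s K ^ p * ν K) ^ (1 / p) *
          (∑ K ∈ C, (⨍⁻ x in K, g x ∂ν) ^ q * ν K) ^ (1 / q) := by
        refine (ENNReal.inner_le_Lp_mul_Lq C _ _ hpq).trans_eq ?_
        congr 3 <;> ext K
        · rw [ENNReal.mul_rpow_of_nonneg _ _ hp.le, ← ENNReal.rpow_mul, one_div_mul_cancel hp.ne',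
            ENNReal.rpow_one]
        · rw [ENNReal.mul_rpow_of_nonneg _ _ hq.le, ← ENNReal.rpow_mul, one_div_mul_cancel hq.ne',
            ENNReal.rpow_one]
      _ ≤ _ := by gcongr

open Classical in
/-- The maximal members of `G` strictly contained in `J`. -/
def children {X : Type*} (G : Finset (Set X)) (J : Set X) : Finset (Set X) :=
  {K ∈ G | K ⊂ J ∧ ∀ L ∈ G, K ⊂ L → ¬ L ⊂ J}

theorem mem_children {X : Type*} {G : Finset (Set X)} {J K : Set X} :
    K ∈ children G J ↔ K ∈ G ∧ K ⊂ J ∧ ∀ L ∈ G, K ⊂ L → ¬ L ⊂ J := by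
  simp [children]

theorem exists_children_superset {X : Type*} {G : Finset (Set X)} {J K : Set X} (hK : K ∈ G)
    (hKJ : K ⊂ J) : ∃ L ∈ children G J, K ⊆ L := by
  classical
  obtain ⟨L, hKL, hL⟩ := ({L ∈ G | L ⊂ J} : Finset (Set X)).exists_le_maximal
    (a := K) (by simp [hK, hKJ])
  have hL' := Finset.mem_filter.1 hL.prop
  refine ⟨L, mem_children.2 ⟨hL'.1, hL'.2, fun M hM hLM hMJ => ?_⟩, hKL⟩
  exact hL.not_gt (Finset.mem_filter.2 ⟨hM, hMJ⟩) hLM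

theorem pairwiseDisjoint_children {X : Type*} {G : Finset (Set X)}
    (hnest : ∀ I ∈ G, ∀ J ∈ G, I ⊆ J ∨ J ⊆ I ∨ Disjoint I J) (J : Set X) :
    (children G J : Set (Set X)).PairwiseDisjoint id := by
  intro K hK L hL hne
  obtain ⟨hKG, hKJ, hK'⟩ := mem_children.1 hK
  obtain ⟨hLG, hLJ, hL'⟩ := mem_children.1 hL
  rcases hnest K hKG L hLG with h | h | h
  · exact absurd hLJ (hK' L hLG (h.ssubset_of_ne hne))
  · exact absurd hKJ (hL' K hKG (h.ssubset_of_ne hne.symm))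
  · exact h

theorem children_disjoint_of_ne {X : Type*} {G : Finset (Set X)} (hne : ∀ J ∈ G, J.Nonempty)
    (hnest : ∀ I ∈ G, ∀ J ∈ G, I ⊆ J ∨ J ⊆ I ∨ Disjoint I J) :
    (G : Set (Set X)).PairwiseDisjoint (children G) := by
  intro I hI J hJ hIJ
  refine Finset.disjoint_left.2 fun K hKI hKJ => ?_
  obtain ⟨hKG, hKI, hI'⟩ := mem_children.1 hKI
  obtain ⟨-, hKJ, hJ'⟩ := mem_children.1 hKJ
  rcases hnest I hI J hJ with h | h | h
  · exact hJ' I hI hKI (h.ssubset_of_ne hIJ)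
  · exact hI' J hJ hKJ (h.ssubset_of_ne hIJ.symm)
  · obtain ⟨x, hx⟩ := hne K hKG
    exact disjoint_left.1 h (hKI.subset hx) (hKJ.subset hx)

theorem pairwiseDisjoint_diff_children {X : Type*} {G : Finset (Set X)}
    (hnest : ∀ I ∈ G, ∀ J ∈ G, I ⊆ J ∨ J ⊆ I ∨ Disjoint I J) :
    (G : Set (Set X)).PairwiseDisjoint fun J => J \ ⋃ K ∈ children G J, K := by
  have key : ∀ I ∈ G, ∀ J : Set X, I ⊂ J →
      Disjoint (I \ ⋃ K ∈ children G I, K) (J \ ⋃ K ∈ children G J, K) := by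
    intro I hI J hIJ
    obtain ⟨L, hL, hIL⟩ := exists_children_superset hI hIJ
    exact disjoint_left.2 fun x hx hx' => hx'.2 (mem_biUnion hL (hIL hx.1))
  intro I hI J hJ hIJ
  rcases hnest I hI J hJ with h | h | h
  · exact key I hI J (h.ssubset_of_ne hIJ)
  · exact (key J hJ I (h.ssubset_of_ne hIJ.symm)).symm
  · exact h.mono sdiff_subset sdiff_subset

/-- One half of the bilinear embedding, for a finite laminar family of sets. -/
theorem bilinear_embedding_laminar {X : Type*} [MeasurableSpace X] {μ ν : Measure X} {p q : ℝ}
    (hpq : p.HolderConjugate q) {f g : X → ℝ≥0∞} (hf : Measurable f) (hg : Measurable g)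
    (hfp : ∫⁻ x, f x ^ p ∂μ ≠ ∞) (F : Finset (Set X)) (hmeas : ∀ I ∈ F, MeasurableSet I)
    (hne : ∀ I ∈ F, I.Nonempty) (hμ : ∀ I ∈ F, μ I ≠ ∞) (hν : ∀ I ∈ F, ν I ≠ ∞)
    (hnest : ∀ I ∈ F, ∀ J ∈ F, I ⊆ J ∨ J ⊆ I ∨ Disjoint I J)
    (hsplit : ∀ I ∈ F, ν I ^ (1 - q) * (∫⁻ x in I, g x ∂ν) ^ q
      ≤ μ I ^ (1 - p) * (∫⁻ x in I, f x ∂μ) ^ p)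
    (c : Set X → ℝ≥0∞)
    (htest : ∀ J ∈ F, ∀ D ⊆ F, (∀ I ∈ D, I ⊆ J) →
      ∫⁻ x in J, (∑ I ∈ D, I.indicator (fun _ => c I * μ I) x) ^ p ∂ν ≤ μ J) :
    ∑ I ∈ F, (∫⁻ x in I, f x ∂μ) * (∫⁻ x in I, g x ∂ν) * c I
      ≤ 2 * 2 ^ (1 / p) * ENNReal.ofReal q * (∫⁻ x, f x ^ p ∂μ) ^ (1 / p) *
          (∫⁻ x, g x ^ q ∂ν) ^ (1 / q)
        + 4 * ENNReal.ofReal q ^ p * ∫⁻ x, f x ^ p ∂μ := by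
  classical
  have hp := hpq.pos
  have hq := hpq.symm.pos
  set a : Set X → ℝ≥0∞ := fun I => ⨍⁻ x in I, f x ∂μ with ha
  obtain ⟨G, hGF, hdouble, hcontrol⟩ := exists_stopping_family F a
  have hnestG : ∀ I ∈ G, ∀ J ∈ G, I ⊆ J ∨ J ⊆ I ∨ Disjoint I J :=
    fun I hI J hJ => hnest I (hGF hI) J (hGF hJ)
  have hafin : ∀ J ∈ G, a J ≠ ∞ := fun J hJ => by
    simp only [ha, setLAverage_eq]
    rcases eq_or_ne (μ J) 0 with h | h
    · simp [Measure.restrict_eq_zero.2 h]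
    · exact ENNReal.div_ne_top (setLIntegral_ne_top_of_rpow hpq hf hfp (hμ J (hGF hJ))) h
  have hT := sum_rpow_mul_measure_le hpq hf G (fun J hJ => hmeas J (hGF hJ))
    (fun J hJ => hμ J (hGF hJ)) hafin
    (fun J hJ => measure_mul_setLAverage f (hμ J (hGF hJ))) hnestG hdouble
  have hpar : ∀ I ∈ F, ∃ J ∈ G, I ⊆ J ∧ a I ≤ 2 * a J ∧ ∀ K ∈ G, I ⊆ K → ¬ K ⊂ J := by
    intro I hI
    obtain ⟨J₀, hJ₀, hIJ₀, haI⟩ := hcontrol I hI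
    obtain ⟨J, hJJ₀, hJ⟩ := ({L ∈ G | I ⊆ L} : Finset (Set X)).exists_le_minimal
      (a := J₀) (by simp [hJ₀, hIJ₀])
    have hJ' := Finset.mem_filter.1 hJ.prop
    refine ⟨J, hJ'.1, hJ'.2, haI.trans ?_, fun K hK hIK hKJ => ?_⟩
    · gcongr
      rcases eq_or_ne J J₀ with rfl | h
      · exact le_rfl
      · exact (le_mul_of_one_le_left' one_le_two).trans
          (hdouble J₀ hJ₀ J hJ'.1 (LE.le.ssubset_of_ne hJJ₀ h))
    · exact hJ.not_lt (Finset.mem_filter.2 ⟨hK, hIK⟩) hKJ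
  choose! π hπG hIπ haπ hπmin using hpar
  set D : Set X → Finset (Set X) := fun J => {I ∈ F | π I = J}
  set S : Set X → X → ℝ≥0∞ := fun J x => ∑ I ∈ D J, I.indicator (fun _ => c I * μ I) x with hSdef
  have hDF : ∀ J, ∀ I ∈ D J, I ∈ F ∧ π I = J := fun J I hI => Finset.mem_filter.1 hI
  have hDJ : ∀ J, ∀ I ∈ D J, I ⊆ J := fun J I hI => (hDF J I hI).2 ▸ hIπ I (hDF J I hI).1
  have hSm : ∀ J, Measurable (S J) := fun J => Finset.measurable_fun_sum _ fun I hI =>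
    measurable_const.indicator (hmeas I (hDF J I hI).1)
  have hSg : ∀ J, ∫⁻ x in J, S J x * g x ∂ν = ∑ I ∈ D J, c I * μ I * ∫⁻ x in I, g x ∂ν := by
    intro J
    simp only [hSdef, Finset.sum_mul]
    rw [lintegral_finsetSum _ fun I hI => by
      exact (measurable_const.indicator (hmeas I (hDF J I hI).1)).mul hg]
    refine Finset.sum_congr rfl fun I hI => ?_
    have hI' := hmeas I (hDF J I hI).1
    simp_rw [← indicator_mul_left I (fun _ => c I * μ I) g]
    rw [lintegral_indicator hI', Measure.restrict_restrict hI', inter_eq_left.2 (hDJ J I hI),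
      lintegral_const_mul _ hg]
  set s : Set X → Set X → ℝ≥0∞ := fun J K => ∑ I ∈ D J, if K ⊆ I then c I * μ I else 0
  have hconst : ∀ J, ∀ K ∈ children G J, ∀ x ∈ K, S J x = s J K := by
    intro J K hK x hx
    obtain ⟨hKG, hKJ, -⟩ := mem_children.1 hK
    refine Finset.sum_congr rfl fun I hI => ?_
    obtain ⟨hIF, hIJ⟩ := hDF J I hI
    rcases hnest I hIF K (hGF hKG) with h | h | h
    · exact absurd (hIJ ▸ hKJ) (hπmin I hIF K hKG h)
    · rw [indicator_of_mem (h hx), if_pos h]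
    · have := disjoint_right.1 h hx
      rw [indicator_of_notMem this, if_neg fun h' => this (h' hx)]
  set E : Set X → ℝ≥0∞ := fun J => ∫⁻ x in J \ ⋃ K ∈ children G J, K, g x ^ q ∂ν
  set Y : Set X → ℝ≥0∞ := fun J => ∑ K ∈ children G J, (⨍⁻ x in K, g x ∂ν) ^ q * ν K
  have hmain : ∀ J ∈ G, ∫⁻ x in J, S J x * g x ∂ν ≤
      μ J ^ (1 / p) * (E J ^ (1 / q) + Y J ^ (1 / q)) := by
    intro J hJ
    have hC : ∀ K ∈ children G J, K ∈ F := fun K hK => hGF (mem_children.1 hK).1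
    refine (setLIntegral_mul_le_of_eq_const hpq (hSm J) hg (children G J)
      (fun K hK => hmeas K (hC K hK)) (fun K hK => hν K (hC K hK))
      (fun K hK => (mem_children.1 hK).2.1.subset) (pairwiseDisjoint_children hnestG J) (s J)
      (hconst J)).trans ?_
    gcongr
    exact htest J (hGF hJ) (D J) (Finset.filter_subset _ _) (hDJ J)
  set T : ℝ≥0∞ := ∑ J ∈ G, a J ^ p * μ J
  have hE : ∑ J ∈ G, E J ≤ ∫⁻ x, g x ^ q ∂ν := by
    rw [← lintegral_biUnion_finset (pairwiseDisjoint_diff_children hnestG)]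
    · exact setLIntegral_le_lintegral _ _
    · exact fun J hJ => (hmeas J (hGF hJ)).diff (Finset.measurableSet_biUnion _ fun K hK =>
        hmeas K (hGF (mem_children.1 hK).1))
  have hY : ∑ J ∈ G, Y J ≤ T := by
    rw [← Finset.sum_biUnion (children_disjoint_of_ne (fun J hJ => hne J (hGF hJ)) hnestG)]
    refine (Finset.sum_le_sum fun K hK => ?_).trans (Finset.sum_le_sum_of_subset
      (Finset.biUnion_subset.2 fun J _ K hK => (mem_children.1 hK).1))
    obtain ⟨J, -, hK⟩ := Finset.mem_biUnion.1 hK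
    have hKF := hGF (mem_children.1 hK).1
    rw [← measure_rpow_mul_setLIntegral_rpow hpq.symm.lt g (hν K hKF),
      ← measure_rpow_mul_setLIntegral_rpow hpq.lt f (hμ K hKF)]
    exact hsplit K hKF
  have hholder : ∀ u : Set X → ℝ≥0∞, ∑ J ∈ G, a J * μ J ^ (1 / p) * u J ^ (1 / q) ≤
      T ^ (1 / p) * (∑ J ∈ G, u J) ^ (1 / q) := by
    intro u
    refine (ENNReal.inner_le_Lp_mul_Lq G _ _ hpq).trans_eq ?_
    congr 3 <;> ext K
    · rw [ENNReal.mul_rpow_of_nonneg _ _ hp.le, ← ENNReal.rpow_mul, one_div_mul_cancel hp.ne',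
        ENNReal.rpow_one]
    · rw [← ENNReal.rpow_mul, one_div_mul_cancel hq.ne', ENNReal.rpow_one]
  calc ∑ I ∈ F, (∫⁻ x in I, f x ∂μ) * (∫⁻ x in I, g x ∂ν) * c I
      = ∑ J ∈ G, ∑ I ∈ D J, (∫⁻ x in I, f x ∂μ) * (∫⁻ x in I, g x ∂ν) * c I :=
        (Finset.sum_fiberwise_of_maps_to hπG _).symm
    _ ≤ ∑ J ∈ G, 2 * (a J * ∫⁻ x in J, S J x * g x ∂ν) := by
        refine Finset.sum_le_sum fun J _ => ?_
        rw [hSg, Finset.mul_sum, Finset.mul_sum]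
        refine Finset.sum_le_sum fun I hI => ?_
        obtain ⟨hIF, hIJ⟩ := hDF J I hI
        rw [← measure_mul_setLAverage f (hμ I hIF)]
        calc μ I * a I * (∫⁻ x in I, g x ∂ν) * c I
            ≤ μ I * (2 * a J) * (∫⁻ x in I, g x ∂ν) * c I := by
              gcongr
              exact hIJ ▸ haπ I hIF
          _ = _ := by ring
    _ ≤ ∑ J ∈ G, 2 * (a J * (μ J ^ (1 / p) * (E J ^ (1 / q) + Y J ^ (1 / q)))) := by
        gcongr with J hJ
        exact hmain J hJ
    _ = 2 * ∑ J ∈ G, a J * μ J ^ (1 / p) * E J ^ (1 / q) +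
          2 * ∑ J ∈ G, a J * μ J ^ (1 / p) * Y J ^ (1 / q) := by
        rw [← mul_add, ← Finset.sum_add_distrib, Finset.mul_sum]
        exact Finset.sum_congr rfl fun J _ => by ring
    _ ≤ 2 * (T ^ (1 / p) * (∑ J ∈ G, E J) ^ (1 / q)) +
          2 * (T ^ (1 / p) * (∑ J ∈ G, Y J) ^ (1 / q)) := by
        gcongr <;> exact hholder _
    _ ≤ 2 * (T ^ (1 / p) * (∫⁻ x, g x ^ q ∂ν) ^ (1 / q)) +
          2 * (T ^ (1 / p) * T ^ (1 / q)) := by gcongr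
    _ = 2 * (T ^ (1 / p) * (∫⁻ x, g x ^ q ∂ν) ^ (1 / q)) + 2 * T := by
        rw [← ENNReal.rpow_add_of_nonneg _ _ (by positivity) (by positivity), one_div,
          one_div, hpq.inv_add_inv_eq_one, ENNReal.rpow_one]
    _ ≤ 2 * ((2 * (ENNReal.ofReal q ^ p * ∫⁻ x, f x ^ p ∂μ)) ^ (1 / p) *
          (∫⁻ x, g x ^ q ∂ν) ^ (1 / q)) +
          2 * (2 * (ENNReal.ofReal q ^ p * ∫⁻ x, f x ^ p ∂μ)) := by gcongr
    _ = _ := by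
        have h1p : 0 ≤ 1 / p := by positivity
        rw [ENNReal.mul_rpow_of_nonneg _ _ h1p, ENNReal.mul_rpow_of_nonneg _ _ h1p,
          ← ENNReal.rpow_mul, mul_one_div_cancel hp.ne', ENNReal.rpow_one]
        ring

theorem measurableSet_dyCube {N : ℕ} (I : DIdx N) : MeasurableSet (dyCube I) := by
  have : dyCube I = univ.pi fun i =>
      Ico ((I.2 i : ℝ) * (2 : ℝ) ^ (-I.1)) (((I.2 i : ℝ) + 1) * (2 : ℝ) ^ (-I.1)) := by
    ext x
    simp [dyCube]
  rw [this]
  exact MeasurableSet.univ_pi fun i => measurableSet_Ico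

theorem dyCube_nonempty {N : ℕ} (I : DIdx N) : (dyCube I).Nonempty := by
  refine ⟨fun i => (I.2 i : ℝ) * (2 : ℝ) ^ (-I.1), fun i => ⟨le_rfl, ?_⟩⟩
  exact mul_lt_mul_of_pos_right (lt_add_one _) (by positivity)

theorem measure_dyCube_ne_top {N : ℕ} (μ : Measure (Fin N → ℝ)) [IsFiniteMeasureOnCompacts μ]
    (I : DIdx N) : μ (dyCube I) ≠ ∞ := by
  refine ne_top_of_le_ne_top (isCompact_Icc (a := fun i => (I.2 i : ℝ) * (2 : ℝ) ^ (-I.1))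
    (b := fun i => ((I.2 i : ℝ) + 1) * (2 : ℝ) ^ (-I.1))).measure_ne_top (measure_mono ?_)
  exact fun x hx => ⟨fun i => (hx i).1, fun i => (hx i).2.le⟩

theorem dyCube_subset_of_le {N : ℕ} {I J : DIdx N} (h : I.1 ≤ J.1) {x : Fin N → ℝ}
    (hI : x ∈ dyCube I) (hJ : x ∈ dyCube J) : dyCube J ⊆ dyCube I := by
  intro y hy i
  obtain ⟨d, hd⟩ := Int.le.dest h
  have hscale : (2 : ℝ) ^ (-I.1) = ((2 ^ d : ℤ) : ℝ) * (2 : ℝ) ^ (-J.1) := by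
    push_cast
    rw [← zpow_natCast, ← zpow_add₀ two_ne_zero]
    congr 1
    omega
  have hpos : (0 : ℝ) < (2 : ℝ) ^ (-J.1) := by positivity
  have h1 := hI i
  have h2 := hJ i
  have h3 := hy i
  rw [hscale, ← mul_assoc, ← mul_assoc] at h1 ⊢
  have hlow : I.2 i * 2 ^ d ≤ J.2 i := by
    have := lt_of_mul_lt_mul_right (h1.1.trans_lt h2.2) hpos.le
    exact Int.lt_add_one_iff.1 (by exact_mod_cast this)
  have hup : J.2 i + 1 ≤ (I.2 i + 1) * 2 ^ d := by
    have := lt_of_mul_lt_mul_right (h2.1.trans_lt h1.2) hpos.le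
    exact Int.add_one_le_iff.2 (by exact_mod_cast this)
  refine ⟨le_trans ?_ h3.1, lt_of_lt_of_le h3.2 ?_⟩
  · gcongr
    exact_mod_cast hlow
  · gcongr
    exact_mod_cast hup

theorem dyCube_laminar {N : ℕ} (I J : DIdx N) :
    dyCube I ⊆ dyCube J ∨ dyCube J ⊆ dyCube I ∨ Disjoint (dyCube I) (dyCube J) := by
  by_cases h : Disjoint (dyCube I) (dyCube J)
  · exact Or.inr (Or.inr h)
  · obtain ⟨x, hI, hJ⟩ := not_disjoint_iff.1 h
    rcases le_total I.1 J.1 with hle | hle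
    · exact Or.inr (Or.inl (dyCube_subset_of_le hle hI hJ))
    · exact Or.inl (dyCube_subset_of_le hle hJ hI)

theorem sum_indicator_le_testFunL {N : ℕ} {ℒ : Set (DIdx N)} (μ : Measure (Fin N → ℝ))
    (α : DIdx N → ℝ) (I₀ : DIdx N) (t : Finset ℒ) (ht : ∀ I ∈ t, dyCube I.1 ⊆ dyCube I₀)
    (x : Fin N → ℝ) :
    ∑ I ∈ t, (dyCube I.1).indicator (fun _ => ENNReal.ofReal (α I.1) * μ (dyCube I.1)) x
      ≤ testFunL ℒ μ α I₀ x := by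
  set w : DIdx N → ℝ≥0∞ := fun I =>
    (dyCube I).indicator (fun _ => ENNReal.ofReal (α I) * μ (dyCube I)) x
  have h : testFunL ℒ μ α I₀ x =
      ∑' I, {I : DIdx N | I ∈ ℒ ∧ dyCube I ⊆ dyCube I₀}.indicator w I := tsum_subtype _ w
  rw [h]
  refine le_trans (le_of_eq ?_)
    (ENNReal.sum_le_tsum (t.map (Function.Embedding.subtype (· ∈ ℒ))))
  rw [Finset.sum_map]
  refine Finset.sum_congr rfl fun I hI => ?_
  exact (indicator_of_mem (s := {I : DIdx N | I ∈ ℒ ∧ dyCube I ⊆ dyCube I₀})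
    ⟨I.2, ht I hI⟩ w).symm

theorem eLpNorm_ofReal_eq_lintegral {X : Type*} [MeasurableSpace X] {μ : Measure X} {p : ℝ}
    (hp : 0 < p) {f : X → ℝ} (hf : 0 ≤ f) :
    eLpNorm f (ENNReal.ofReal p) μ = (∫⁻ x, ENNReal.ofReal (f x) ^ p ∂μ) ^ (1 / p) := by
  rw [eLpNorm_eq_lintegral_rpow_enorm_toReal (by simpa using hp) ENNReal.ofReal_ne_top,
    ENNReal.toReal_ofReal hp.le]
  simp_rw [fun x => Real.enorm_of_nonneg (hf x)]

/-- **Proposition (one half of the bilinear embedding).** Under the splitting condition and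
the testing condition for `α` over `ℒ`, the bilinear sum over `ℒ` is bounded by
`A ‖f‖_{L^p(μ)} ‖g‖_{L^{p'}(ν)} + B ‖f‖_{L^p(μ)}^p` with `A = 2^{1+1/p} p'`, `B = 4 (p')^p`. -/
theorem bilinear_embedding_half (N : ℕ) (p p' : ℝ) (hp : 1 < p) (hpp' : 1 / p + 1 / p' = 1)
    (μ ν : Measure (Fin N → ℝ))
    [IsFiniteMeasureOnCompacts μ] [IsFiniteMeasureOnCompacts ν]
    (ℒ : Set (DIdx N)) (f g : (Fin N → ℝ) → ℝ)
    (hf : Measurable f) (hf0 : 0 ≤ f) (hg : Measurable g) (hg0 : 0 ≤ g)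
    (hsplit : ∀ I ∈ ℒ,
      ν (dyCube I) ^ (1 - p') * (∫⁻ x in dyCube I, ENNReal.ofReal (g x) ∂ν) ^ p'
        ≤ μ (dyCube I) ^ (1 - p) * (∫⁻ x in dyCube I, ENNReal.ofReal (f x) ∂μ) ^ p)
    (α : DIdx N → ℝ) (hα : ∀ I, 0 ≤ α I)
    (htest : ∀ I₀ ∈ ℒ,
      ∫⁻ x in dyCube I₀, (testFunL ℒ μ α I₀ x) ^ p ∂ν ≤ μ (dyCube I₀)) :
    ∑' I : ℒ,
        (∫⁻ x in dyCube I.1, ENNReal.ofReal (f x) ∂μ)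
          * (∫⁻ x in dyCube I.1, ENNReal.ofReal (g x) ∂ν) * ENNReal.ofReal (α I.1)
      ≤ ENNReal.ofReal ((2 : ℝ) ^ (1 + 1 / p) * p')
            * eLpNorm f (ENNReal.ofReal p) μ * eLpNorm g (ENNReal.ofReal p') ν
        + ENNReal.ofReal (4 * p' ^ p) * eLpNorm f (ENNReal.ofReal p) μ ^ p := by
  classical
  have hpq : p.HolderConjugate p' := Real.holderConjugate_iff.2 ⟨hp, by simpa using hpp'⟩
  have hp0 := hpq.pos
  have hq0 := hpq.symm.pos
  rw [eLpNorm_ofReal_eq_lintegral hp0 hf0, eLpNorm_ofReal_eq_lintegral hq0 hg0,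
    ← ENNReal.rpow_mul, one_div_mul_cancel hp0.ne', ENNReal.rpow_one]
  by_cases hfp : ∫⁻ x, ENNReal.ofReal (f x) ^ p ∂μ = ∞
  · rw [hfp, ENNReal.mul_top, add_top]
    · exact le_top
    · have : 0 < 4 * p' ^ p := by positivity
      simpa using this
  rw [ENNReal.tsum_eq_iSup_sum]
  refine iSup_le fun s => ?_
  set Q : ℒ → Set (Fin N → ℝ) := fun I => dyCube I.1
  set c : Set (Fin N → ℝ) → ℝ≥0∞ := fun K => ∑ I ∈ s with Q I = K, ENNReal.ofReal (α I.1)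
    with hc
  have hmem : ∀ K ∈ s.image Q, ∃ I : ℒ, dyCube I.1 = K := fun K hK => by
    obtain ⟨I, -, h⟩ := Finset.mem_image.1 hK
    exact ⟨I, h⟩
  have key := bilinear_embedding_laminar hpq hf.ennreal_ofReal hg.ennreal_ofReal (ν := ν) hfp
    (s.image Q)
    (fun K hK => by obtain ⟨I, rfl⟩ := hmem K hK; exact measurableSet_dyCube _)
    (fun K hK => by obtain ⟨I, rfl⟩ := hmem K hK; exact dyCube_nonempty _)
    (fun K hK => by obtain ⟨I, rfl⟩ := hmem K hK; exact measure_dyCube_ne_top μ _)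
    (fun K hK => by obtain ⟨I, rfl⟩ := hmem K hK; exact measure_dyCube_ne_top ν _)
    (fun K hK L hL => by
      obtain ⟨I, rfl⟩ := hmem K hK
      obtain ⟨J, rfl⟩ := hmem L hL
      exact dyCube_laminar _ _)
    (fun K hK => by obtain ⟨I, rfl⟩ := hmem K hK; exact hsplit I.1 I.2) c
    (fun K hK D hD hDK => by
      obtain ⟨I₀, rfl⟩ := hmem K hK
      refine le_trans (lintegral_mono fun x => ENNReal.rpow_le_rpow ?_ hp0.le)
        (htest I₀.1 I₀.2)
      refine le_trans (le_of_eq ?_) (sum_indicator_le_testFunL μ α I₀.1 {I ∈ s | Q I ∈ D}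
        (fun I hI => hDK _ (Finset.mem_filter.1 hI).2) x)
      rw [← Finset.sum_fiberwise_of_maps_to (t := D) (g := Q)
        fun I hI => (Finset.mem_filter.1 hI).2]
      refine Finset.sum_congr rfl fun L hL => ?_
      have hfilter : {I ∈ ({I ∈ s | Q I ∈ D} : Finset ℒ) | Q I = L} =
          ({I ∈ s | Q I = L} : Finset ℒ) := by
        ext I
        simp only [Finset.mem_filter]
        exact ⟨fun h => ⟨h.1.1, h.2⟩, fun h => ⟨⟨h.1, h.2 ▸ hL⟩, h.2⟩⟩
      rw [hfilter]
      by_cases hx : x ∈ L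
      · rw [indicator_of_mem hx, hc, Finset.sum_mul]
        refine Finset.sum_congr rfl fun I hI => ?_
        obtain rfl := (Finset.mem_filter.1 hI).2
        exact (indicator_of_mem (s := dyCube I.1) hx
          fun _ => ENNReal.ofReal (α I.1) * μ (dyCube I.1)).symm
      · rw [indicator_of_notMem hx]
        refine (Finset.sum_eq_zero fun I hI => ?_).symm
        obtain rfl := (Finset.mem_filter.1 hI).2
        exact indicator_of_notMem (s := Q I) hx _)
  have hsum : ∑ I ∈ s, (∫⁻ x in dyCube I.1, ENNReal.ofReal (f x) ∂μ)
        * (∫⁻ x in dyCube I.1, ENNReal.ofReal (g x) ∂ν) * ENNReal.ofReal (α I.1) =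
      ∑ K ∈ s.image Q, (∫⁻ x in K, ENNReal.ofReal (f x) ∂μ)
        * (∫⁻ x in K, ENNReal.ofReal (g x) ∂ν) * c K := by
    rw [← Finset.sum_fiberwise_of_maps_to (fun I hI => Finset.mem_image_of_mem Q hI)]
    refine Finset.sum_congr rfl fun K _ => ?_
    rw [hc, Finset.mul_sum]
    refine Finset.sum_congr rfl fun I hI => ?_
    obtain rfl := (Finset.mem_filter.1 hI).2
    rfl
  have hA : ENNReal.ofReal ((2 : ℝ) ^ (1 + 1 / p) * p') =
      2 * 2 ^ (1 / p) * ENNReal.ofReal p' := by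
    rw [Real.rpow_add two_pos, Real.rpow_one, ENNReal.ofReal_mul (by positivity),
      ENNReal.ofReal_mul two_pos.le, ← ENNReal.ofReal_rpow_of_pos two_pos]
    simp
  have hB : ENNReal.ofReal (4 * p' ^ p) = 4 * ENNReal.ofReal p' ^ p := by
    rw [ENNReal.ofReal_mul (by norm_num), ← ENNReal.ofReal_rpow_of_pos hq0]
    simp
  rw [hsum, hA, hB]
  exact key
end
end

section
/- Let 1 < p < ∞, let μ and ν be Radon measures on ℝ^N, let ℒ ⊆ 𝒟, let f ≥ 0 be measurable, and let α_I ≥ 0, I ∈ ℒ, satisfy the testing condition: for all I₀ ∈ ℒ, ∫_{I₀} (Σ_{I∈ℒ, I⊆I₀} α_I μ(I) 𝟙_I)^p dν ≤ μ(I₀). Let J ∈ ℒ with μ(J) > 0 and let 𝓔(J) ⊆ ℒ(J) = {I ∈ ℒ : I ⊆ J} be any subcollection such that every I ∈ 𝓔(J) satisfies ∫_I f dμ < 2 μ(I) (μ(J)^{-1} ∫_J f dμ). Set F_{𝓔(J)} = Σ_{I∈𝓔(J)} α_I (∫_I f dμ) 𝟙_I. Then ‖F_{𝓔(J)}‖_{L^p(ν)}^p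 ≤ 2^p (μ(J)^{-1} ∫_J f dμ)^p μ(J). -/
open MeasureTheory ENNReal Set

noncomputable section

/-- The average `μ(I)^{-1} ∫_I f dμ` of a nonnegative function over a dyadic cube. -/
def dyAvg {N : ℕ} (μ : Measure (Fin N → ℝ)) (f : (Fin N → ℝ) → ℝ) (I : DIdx N) : ℝ≥0∞ :=
  (μ (dyCube I))⁻¹ * ∫⁻ x in dyCube I, ENNReal.ofReal (f x) ∂μ

/-- The function `F_𝓔 = Σ_{I ∈ 𝓔} α_I (∫_I f dμ) 𝟙_I`. -/
def FE {N : ℕ} (𝓔 : Set (DIdx N)) (μ : Measure (Fin N → ℝ)) (α : DIdx N → ℝ)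
    (f : (Fin N → ℝ) → ℝ) (x : Fin N → ℝ) : ℝ≥0∞ :=
  ∑' I : 𝓔,
    (dyCube I.1).indicator
      (fun _ => ENNReal.ofReal (α I.1) * ∫⁻ y in dyCube I.1, ENNReal.ofReal (f y) ∂μ) x

theorem measurable_testFunL {N : ℕ} (ℒ : Set (DIdx N)) (μ : Measure (Fin N → ℝ))
    (α : DIdx N → ℝ) (J : DIdx N) : Measurable (testFunL ℒ μ α J) :=
  Measurable.tsum fun I => measurable_const.indicator (measurableSet_dyCube I.1)

/-- `F_𝓔` vanishes off any set containing all cubes of `𝓔`. -/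
theorem FE_eq_zero_of_notMem {N : ℕ} {𝓔 : Set (DIdx N)} {μ : Measure (Fin N → ℝ)}
    {α : DIdx N → ℝ} {f : (Fin N → ℝ) → ℝ} {s : Set (Fin N → ℝ)}
    (h𝓔 : ∀ I ∈ 𝓔, dyCube I ⊆ s) {x : Fin N → ℝ} (hx : x ∉ s) : FE 𝓔 μ α f x = 0 :=
  ENNReal.tsum_eq_zero.2 fun I => indicator_of_notMem (fun h => hx (h𝓔 I.1 I.2 h)) _

/-- If `∫_I f dμ ≤ c μ(I)` for all `I ∈ 𝓔`, then `F_𝓔` is pointwise at most `c` times the function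
in the testing condition. -/
theorem FE_le_mul_testFunL {N : ℕ} {ℒ 𝓔 : Set (DIdx N)} {μ : Measure (Fin N → ℝ)}
    {α : DIdx N → ℝ} {f : (Fin N → ℝ) → ℝ} {J : DIdx N} {c : ℝ≥0∞}
    (h𝓔 : 𝓔 ⊆ {I | I ∈ ℒ ∧ dyCube I ⊆ dyCube J})
    (hc : ∀ I ∈ 𝓔, (∫⁻ x in dyCube I, ENNReal.ofReal (f x) ∂μ) ≤ c * μ (dyCube I))
    (x : Fin N → ℝ) : FE 𝓔 μ α f x ≤ c * testFunL ℒ μ α J x := by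
  rw [testFunL, ← ENNReal.tsum_mul_left]
  refine le_trans (ENNReal.tsum_le_tsum fun I => ?_)
    (ENNReal.tsum_comp_le_tsum_of_injective (inclusion_injective h𝓔) _)
  by_cases hx : x ∈ dyCube I.1
  · simp only [indicator_of_mem hx]
    rw [mul_left_comm]
    gcongr
    exact hc I.1 I.2
  · simp [indicator_of_notMem hx]

/-- **The `L^p(ν)`-bound for `F_{𝓔(J)}`:**
`‖F_{𝓔(J)}‖_{L^p(ν)}^p ≤ 2^p (μ(J)^{-1} ∫_J f dμ)^p μ(J)`. -/
theorem lp_norm_FE_le (N : ℕ) (p : ℝ) (hp : 1 < p)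
    (μ ν : Measure (Fin N → ℝ))
    [IsFiniteMeasureOnCompacts μ] [IsFiniteMeasureOnCompacts ν]
    (ℒ : Set (DIdx N)) (f : (Fin N → ℝ) → ℝ) (hf : Measurable f) (hf0 : 0 ≤ f)
    (α : DIdx N → ℝ) (hα : ∀ I, 0 ≤ α I)
    (htest : ∀ I₀ ∈ ℒ,
      ∫⁻ x in dyCube I₀, (testFunL ℒ μ α I₀ x) ^ p ∂ν ≤ μ (dyCube I₀))
    (J : DIdx N) (hJ : J ∈ ℒ) (hJ0 : 0 < μ (dyCube J))
    (𝓔 : Set (DIdx N)) (h𝓔 : 𝓔 ⊆ {I | I ∈ ℒ ∧ dyCube I ⊆ dyCube J})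
    (h𝓔avg : ∀ I ∈ 𝓔,
      (∫⁻ x in dyCube I, ENNReal.ofReal (f x) ∂μ) < 2 * μ (dyCube I) * dyAvg μ f J) :
    ∫⁻ x, (FE 𝓔 μ α f x) ^ p ∂ν ≤ (2 : ℝ≥0∞) ^ p * (dyAvg μ f J) ^ p * μ (dyCube J) := by
  have hp0 : 0 < p := one_pos.trans hp
  calc ∫⁻ x, (FE 𝓔 μ α f x) ^ p ∂ν
      ≤ ∫⁻ x, (dyCube J).indicator
          (fun x => (2 * dyAvg μ f J) ^ p * (testFunL ℒ μ α J x) ^ p) x ∂ν := by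
        refine lintegral_mono fun x => ?_
        by_cases hx : x ∈ dyCube J
        · rw [indicator_of_mem hx, ← ENNReal.mul_rpow_of_nonneg _ _ hp0.le]
          exact ENNReal.rpow_le_rpow
            (FE_le_mul_testFunL h𝓔 (fun I hI => by
              rw [mul_right_comm]; exact (h𝓔avg I hI).le) x) hp0.le
        · rw [indicator_of_notMem hx, FE_eq_zero_of_notMem (fun I hI => (h𝓔 hI).2) hx,
            ENNReal.zero_rpow_of_pos hp0]
    _ = (2 * dyAvg μ f J) ^ p * ∫⁻ x in dyCube J, (testFunL ℒ μ α J x) ^ p ∂ν := by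
        rw [lintegral_indicator (measurableSet_dyCube J),
          lintegral_const_mul _ ((measurable_testFunL ℒ μ α J).pow_const p)]
    _ ≤ (2 * dyAvg μ f J) ^ p * μ (dyCube J) := by
        gcongr
        exact htest J hJ
    _ = (2 : ℝ≥0∞) ^ p * (dyAvg μ f J) ^ p * μ (dyCube J) := by
        rw [ENNReal.mul_rpow_of_nonneg _ _ hp0.le]
end
end
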